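/- Let 1 ≤ p < ∞, let μ be a locally finite Borel measure on ℝ^d, let h be a nonnegative real-valued locally integrable function, and let {R} be a collection of pairwise disjoint dyadic cubes, with R̂ denoting the dyadic parent of R. Then ‖Σ_R (∫_R h dμ) 1_{R̂}/μ(R̂)‖_{L^p(μ)} ≤ C(p) (sup_R ⟨h⟩^μ_{R̂})^{1/p'} (∫_{∪_R R} h dμ)^{1/p}, where p' is the conjugate exponent of p and C(p) depends only on p. -/

import Mathlib

open MeasureTheory ENNReal
open scoped Classical

/-- A dyadic cube `2^{-k}([0,1)^d + j)` in `ℝ^d`, encoded by its scale `k` and position `j`. -/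
structure DCube (d : ℕ) where
  k : ℤ
  j : Fin d → ℤ
deriving DecidableEq

namespace DCube
variable {d : ℕ}

/-- The dyadic cube as a subset of `ℝ^d`. -/
def toSet (Q : DCube d) : Set (Fin d → ℝ) :=
  {x | ∀ i, (2:ℝ) ^ (-Q.k) * Q.j i ≤ x i ∧ x i < (2:ℝ) ^ (-Q.k) * (Q.j i + 1)}

/-- The dyadic parent of a dyadic cube. -/
def parent (Q : DCube d) : DCube d := ⟨Q.k - 1, fun i => Int.fdiv (Q.j i) 2⟩

end DCube

/-- The `μ`-average `⟨f⟩^μ_Q` of a vector-valued function over a dyadic cube. -/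
noncomputable def cubeAvg {d : ℕ} {E : Type*} [NormedAddCommGroup E] [NormedSpace ℝ E]
    (μ : Measure (Fin d → ℝ)) (Q : DCube d) (f : (Fin d → ℝ) → E) : E :=
  (μ Q.toSet).toReal⁻¹ • ∫ x in Q.toSet, f x ∂μ

/-- One-step binomial bound `(s + a)^{n+1} ≤ s^{n+1} + (n+1) a (s + a)^n` in `ℝ≥0∞`. -/
theorem ENNReal.add_pow_succ_le (s a : ℝ≥0∞) (n : ℕ) :
    (s + a) ^ (n + 1) ≤ s ^ (n + 1) + (n + 1) * (a * (s + a) ^ n) := by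
  induction n with
  | zero => simp
  | succ n ih =>
    calc (s + a) ^ (n + 1 + 1) = (s + a) ^ (n + 1) * s + a * (s + a) ^ (n + 1) := by ring
      _ ≤ (s ^ (n + 1) + (n + 1) * (a * (s + a) ^ n)) * s + a * (s + a) ^ (n + 1) := by gcongr
      _ = s ^ (n + 1 + 1) + ((n + 1) * (a * ((s + a) ^ n * s)) + a * (s + a) ^ (n + 1)) := by
        ring
      _ ≤ s ^ (n + 1 + 1) +
          ((n + 1) * (a * ((s + a) ^ n * (s + a))) + a * (s + a) ^ (n + 1)) := by
        gcongr
        exact le_self_add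
      _ = s ^ (n + 1 + 1) + ((n + 1 : ℕ) + 1) * (a * (s + a) ^ (n + 1)) := by
        push_cast
        ring

/-- Summation by parts for powers of a finite sum ordered by a rank function `k`. -/
theorem ENNReal.sum_pow_succ_le {ι : Type*} (k : ι → ℤ) (a : ι → ℝ≥0∞) (n : ℕ) (S : Finset ι) :
    (∑ i ∈ S, a i) ^ (n + 1) ≤
      (n + 1) * ∑ i ∈ S, a i * (∑ j ∈ S with k i ≤ k j, a j) ^ n := by
  induction S using Finset.induction_on_min_value k with
  | empty => simp
  | insert e S he hmin ih =>
    have hall : (insert e S).filter (fun j => k e ≤ k j) = insert e S :=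
      Finset.filter_true_of_mem fun j hj => by
        rcases Finset.mem_insert.1 hj with rfl | hj
        exacts [le_rfl, hmin j hj]
    rw [Finset.sum_insert he, Finset.sum_insert he, hall, Finset.sum_insert he, add_comm (a e),
      mul_add, add_comm (_ * _)]
    refine (ENNReal.add_pow_succ_le _ _ _).trans ?_
    gcongr
    refine ih.trans ?_
    gcongr
    exact Finset.subset_insert _ _

/-- For `1 ≤ p ≤ n`, the power `x ^ p` is dominated by the powers `x` and `x ^ n`, at any
scale `A`. -/
theorem ENNReal.rpow_le_add_rpow_mul_pow {p : ℝ} (hp : 1 ≤ p) {n : ℕ} (hn : p ≤ n)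
    {A : ℝ≥0∞} (hA : A ≠ 0) (hA' : A ≠ ⊤) (x : ℝ≥0∞) :
    x ^ p ≤ A ^ (p - 1) * x + A ^ (p - n) * x ^ n := by
  rcases le_total x A with h | h
  · refine le_add_right ?_
    calc x ^ p = x ^ (p - 1) * x ^ (1 : ℝ) := by
          rw [← ENNReal.rpow_add_of_nonneg _ _ (by linarith) zero_le_one]
          simp
      _ ≤ A ^ (p - 1) * x := by
          rw [ENNReal.rpow_one]
          have : 0 ≤ p - 1 := by linarith
          gcongr
  · refine le_add_left ?_
    calc x ^ p = A ^ (p - n) * (A ^ (n - p) * x ^ p) := by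
          rw [← mul_assoc, ← ENNReal.rpow_add _ _ hA hA']
          simp
      _ ≤ A ^ (p - n) * (x ^ (n - p) * x ^ p) := by
          have : 0 ≤ n - p := by linarith
          gcongr
      _ = A ^ (p - n) * x ^ n := by
          rw [← ENNReal.rpow_add_of_nonneg _ _ (by linarith) (by linarith)]
          simp

section Smeared

variable {α ι : Type*} [MeasurableSpace α] {μ : Measure α} {g : α → ℝ≥0∞}
  {E Q : ι → Set α} {k : ι → ℤ} {T : Finset ι} {A : ℝ≥0∞}

/-- The sum over `i ∈ T` of the mass of `g` on `E i`, spread uniformly over `Q i`. -/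
noncomputable def smearedSum (μ : Measure α) (g : α → ℝ≥0∞) (E Q : ι → Set α) (T : Finset ι)
    (x : α) : ℝ≥0∞ :=
  ∑ i ∈ T, (Q i).indicator (fun _ => (μ (Q i))⁻¹ * ∫⁻ y in E i, g y ∂μ) x

theorem measurable_smearedSum (hQ : ∀ i, MeasurableSet (Q i)) :
    Measurable (smearedSum μ g E Q T) :=
  Finset.measurable_sum _ fun i _ => measurable_const.indicator (hQ i)

theorem smearedSum_eq_sum_filter (x : α) :
    smearedSum μ g E Q T x =
      ∑ i ∈ T with x ∈ Q i, (μ (Q i))⁻¹ * ∫⁻ y in E i, g y ∂μ := by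
  simp only [smearedSum, Finset.sum_filter, Set.indicator_apply]

theorem lintegral_smearedSum_le (hQ : ∀ i, MeasurableSet (Q i)) :
    ∫⁻ x, smearedSum μ g E Q T x ∂μ ≤ ∑ i ∈ T, ∫⁻ y in E i, g y ∂μ := by
  unfold smearedSum
  rw [lintegral_finsetSum _ fun i _ => measurable_const.indicator (hQ i)]
  refine Finset.sum_le_sum fun i _ => ?_
  rw [lintegral_indicator_const (hQ i), mul_right_comm]
  exact mul_le_of_le_one_left' (ENNReal.inv_mul_le_one _)

theorem smearedSum_pow_succ_le
    (hnest : ∀ i j, k i ≤ k j → ∀ x ∈ Q i, x ∈ Q j → Q j ⊆ Q i) (n : ℕ) (x : α) :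
    smearedSum μ g E Q T x ^ (n + 1) ≤ (n + 1) * ∑ i ∈ T,
      ((μ (Q i))⁻¹ * ∫⁻ y in E i, g y ∂μ) *
        smearedSum μ g E Q (T.filter fun j => Q j ⊆ Q i) x ^ n := by
  rw [smearedSum_eq_sum_filter]
  refine (ENNReal.sum_pow_succ_le k _ n _).trans ?_
  gcongr (_ : ℝ≥0∞) * ?_
  refine (Finset.sum_le_sum fun i hi => ?_).trans
    (Finset.sum_le_sum_of_subset (Finset.filter_subset (fun i => x ∈ Q i) T))
  rw [smearedSum_eq_sum_filter]
  gcongr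
  intro j hj
  simp only [Finset.mem_filter] at hi hj ⊢
  exact ⟨⟨hj.1.1, hnest i j hj.2 x hi.2 hj.1.2⟩, hj.1.2⟩

theorem lintegral_smearedSum_pow_le (hE : ∀ i, MeasurableSet (E i))
    (hQ : ∀ i, MeasurableSet (Q i)) (hEQ : ∀ i, E i ⊆ Q i)
    (hnest : ∀ i j, k i ≤ k j → ∀ x ∈ Q i, x ∈ Q j → Q j ⊆ Q i) (n : ℕ)
    (hdisj : (T : Set ι).PairwiseDisjoint E)
    (hA : ∀ i ∈ T, (μ (Q i))⁻¹ * ∫⁻ y in Q i, g y ∂μ ≤ A) :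
    ∫⁻ x, smearedSum μ g E Q T x ^ (n + 1) ∂μ ≤
      (n + 1).factorial * (A ^ n * ∑ i ∈ T, ∫⁻ y in E i, g y ∂μ) := by
  induction n generalizing T with
  | zero => simpa using lintegral_smearedSum_le hQ
  | succ n ih =>
    calc ∫⁻ x, smearedSum μ g E Q T x ^ (n + 1 + 1) ∂μ
        ≤ ∫⁻ x, ((n + 1 : ℕ) + 1) * ∑ i ∈ T, ((μ (Q i))⁻¹ * ∫⁻ y in E i, g y ∂μ) *
            smearedSum μ g E Q (T.filter fun j => Q j ⊆ Q i) x ^ (n + 1) ∂μ :=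
          lintegral_mono fun x => smearedSum_pow_succ_le hnest (n + 1) x
      _ = ((n + 1 : ℕ) + 1) * ∑ i ∈ T, ((μ (Q i))⁻¹ * ∫⁻ y in E i, g y ∂μ) *
            ∫⁻ x, smearedSum μ g E Q (T.filter fun j => Q j ⊆ Q i) x ^ (n + 1) ∂μ := by
          have hm (i : ι) : Measurable fun x =>
              smearedSum μ g E Q (T.filter fun j => Q j ⊆ Q i) x ^ (n + 1) :=
            (measurable_smearedSum hQ).pow_const _
          rw [lintegral_const_mul _ (Finset.measurable_sum _ fun i _ => (hm i).const_mul _),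
            lintegral_finsetSum _ fun i _ => (hm i).const_mul _]
          simp_rw [lintegral_const_mul _ (hm _)]
      _ ≤ ((n + 1 : ℕ) + 1) * ∑ i ∈ T,
            (n + 1).factorial * (A ^ (n + 1) * ∫⁻ y in E i, g y ∂μ) := by
          gcongr (_ : ℝ≥0∞) * ?_
          refine Finset.sum_le_sum fun i hi => ?_
          have hsub : T.filter (fun j => Q j ⊆ Q i) ⊆ T := Finset.filter_subset _ _
          have hdisj' := hdisj.subset (Finset.coe_subset.2 hsub)
          have hmass : ∑ j ∈ T with Q j ⊆ Q i, ∫⁻ y in E j, g y ∂μ ≤ ∫⁻ y in Q i, g y ∂μ := by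
            rw [← lintegral_biUnion_finset hdisj' fun j _ => hE j]
            refine lintegral_mono_set (Set.iUnion₂_subset fun j hj => ?_)
            exact (hEQ j).trans (Finset.mem_filter.1 hj).2
          calc _ ≤ ((μ (Q i))⁻¹ * ∫⁻ y in E i, g y ∂μ) *
                ((n + 1).factorial * (A ^ n * ∫⁻ y in Q i, g y ∂μ)) := by
                gcongr
                refine (ih hdisj' fun j hj => hA j (hsub hj)).trans ?_
                gcongr
            _ = (n + 1).factorial * (A ^ n * ((μ (Q i))⁻¹ * ∫⁻ y in Q i, g y ∂μ) *
                  ∫⁻ y in E i, g y ∂μ) := by ring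
            _ ≤ (n + 1).factorial * (A ^ n * A * ∫⁻ y in E i, g y ∂μ) := by
                gcongr
                exact hA i hi
            _ = _ := by rw [pow_succ]
      _ = _ := by
          rw [← Finset.mul_sum, ← Finset.mul_sum, Nat.factorial_succ (n + 1)]
          push_cast
          ring

theorem lintegral_smearedSum_rpow_le (hE : ∀ i, MeasurableSet (E i))
    (hQ : ∀ i, MeasurableSet (Q i)) (hEQ : ∀ i, E i ⊆ Q i)
    (hnest : ∀ i j, k i ≤ k j → ∀ x ∈ Q i, x ∈ Q j → Q j ⊆ Q i)
    (hdisj : (T : Set ι).PairwiseDisjoint E)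
    (hA : ∀ i ∈ T, (μ (Q i))⁻¹ * ∫⁻ y in Q i, g y ∂μ ≤ A)
    {p : ℝ} (hp : 1 ≤ p) :
    ∫⁻ x, smearedSum μ g E Q T x ^ p ∂μ ≤
      (1 + (⌈p⌉₊).factorial) * (A ^ (p - 1) * ∑ i ∈ T, ∫⁻ y in E i, g y ∂μ) := by
  have hp0 : 0 < p := by linarith
  set M := ∑ i ∈ T, ∫⁻ y in E i, g y ∂μ with hM
  have hzero (h : ∀ i ∈ T, (μ (Q i))⁻¹ * ∫⁻ y in E i, g y ∂μ = 0) :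
      ∫⁻ x, smearedSum μ g E Q T x ^ p ∂μ = 0 := by
    have (x : α) : smearedSum μ g E Q T x = 0 := by
      rw [smearedSum_eq_sum_filter]
      exact Finset.sum_eq_zero fun i hi => h i (Finset.mem_filter.1 hi).1
    simp [this, hp0]
  rcases eq_or_ne A 0 with rfl | hA0
  · rw [hzero fun i hi => ?_]
    · exact zero_le
    · refine le_antisymm (le_trans ?_ (hA i hi)) zero_le
      gcongr
      exact hEQ i
  rcases eq_or_ne M 0 with hM0 | hM0
  · rw [hzero fun i hi => ?_]
    · exact zero_le
    · rw [Finset.sum_eq_zero_iff.1 hM0 i hi, mul_zero]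
  rcases eq_or_ne A ⊤ with rfl | hAtop
  · rcases hp.eq_or_lt with rfl | hp1
    · simpa using (lintegral_smearedSum_le hQ).trans (le_mul_of_one_le_left' (by norm_num))
    · rw [ENNReal.top_rpow_of_pos (by linarith), ENNReal.top_mul hM0,
        ENNReal.mul_top (by simp)]
      exact le_top
  obtain ⟨n, hn⟩ : ∃ n, ⌈p⌉₊ = n + 1 :=
    Nat.exists_eq_succ_of_ne_zero (Nat.ceil_pos.2 hp0).ne'
  have hpn : p ≤ (n + 1 : ℕ) := hn ▸ Nat.le_ceil p
  rw [hn]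
  have hF : Measurable (smearedSum μ g E Q T) := measurable_smearedSum hQ
  calc ∫⁻ x, smearedSum μ g E Q T x ^ p ∂μ
      ≤ ∫⁻ x, (A ^ (p - 1) * smearedSum μ g E Q T x +
          A ^ (p - (n + 1 : ℕ)) * smearedSum μ g E Q T x ^ (n + 1)) ∂μ :=
        lintegral_mono fun x => ENNReal.rpow_le_add_rpow_mul_pow hp hpn hA0 hAtop _
    _ = A ^ (p - 1) * ∫⁻ x, smearedSum μ g E Q T x ∂μ +
          A ^ (p - (n + 1 : ℕ)) * ∫⁻ x, smearedSum μ g E Q T x ^ (n + 1) ∂μ := by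
        rw [lintegral_add_left (hF.const_mul _), lintegral_const_mul _ hF,
          lintegral_const_mul _ (hF.pow_const _)]
    _ ≤ A ^ (p - 1) * M + A ^ (p - (n + 1 : ℕ)) * ((n + 1).factorial * (A ^ n * M)) := by
        gcongr
        · exact lintegral_smearedSum_le hQ
        · exact lintegral_smearedSum_pow_le hE hQ hEQ hnest n hdisj hA
    _ = A ^ (p - 1) * M + (n + 1).factorial * ((A ^ (p - (n + 1 : ℕ)) * A ^ (n : ℝ)) * M) := by
        rw [ENNReal.rpow_natCast]
        ring
    _ = _ := by
        rw [← ENNReal.rpow_add _ _ hA0 hAtop]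
        have : p - (n + 1 : ℕ) + n = p - 1 := by
          push_cast
          ring
        rw [this]
        ring

end Smeared

namespace DCube

variable {d : ℕ}

theorem measurableSet_toSet (Q : DCube d) : MeasurableSet Q.toSet := by
  have : Q.toSet = Set.univ.pi fun i =>
      Set.Ico ((2 : ℝ) ^ (-Q.k) * Q.j i) ((2 : ℝ) ^ (-Q.k) * (Q.j i + 1)) := by
    ext x
    simp [toSet, Set.mem_pi]
  rw [this]
  exact MeasurableSet.univ_pi fun i => measurableSet_Ico

theorem toSet_subset_parent (Q : DCube d) : Q.toSet ⊆ Q.parent.toSet := by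
  intro x hx i
  obtain ⟨h1, h2⟩ := hx i
  have hpow : (2 : ℝ) ^ (-Q.parent.k) = 2 ^ (-Q.k) * 2 := by
    rw [parent, neg_sub, sub_eq_neg_add, zpow_add₀ two_ne_zero, zpow_one]
  have hj : 2 * Q.parent.j i ≤ Q.j i ∧ Q.j i + 1 ≤ 2 * (Q.parent.j i + 1) := by
    simp only [parent, Int.fdiv_eq_ediv_of_nonneg _ (zero_le_two : (0 : ℤ) ≤ 2)]
    omega
  have hj1 : (2 : ℝ) * Q.parent.j i ≤ Q.j i := mod_cast hj.1
  have hj2 : (Q.j i : ℝ) + 1 ≤ 2 * (Q.parent.j i + 1) := mod_cast hj.2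
  rw [hpow, mul_assoc, mul_assoc]
  exact ⟨le_trans (by gcongr) h1, h2.trans_le (by gcongr)⟩

theorem toSet_subset_of_mem_of_le {Q Q' : DCube d} (hk : Q.k ≤ Q'.k) {x : Fin d → ℝ}
    (hx : x ∈ Q.toSet) (hx' : x ∈ Q'.toSet) : Q'.toSet ⊆ Q.toSet := by
  obtain ⟨n, hn⟩ := Int.le.dest hk
  have hpow : (2 : ℝ) ^ (-Q.k) = 2 ^ (-Q'.k) * 2 ^ n := by
    rw [← hn, ← zpow_natCast, ← zpow_add₀ two_ne_zero]
    congr 1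
    ring
  have hpos : (0 : ℝ) < 2 ^ (-Q'.k) := by positivity
  intro y hy i
  obtain ⟨a1, a2⟩ := hx i
  obtain ⟨b1, b2⟩ := hx' i
  obtain ⟨c1, c2⟩ := hy i
  rw [hpow, mul_assoc] at a1 a2 ⊢
  rw [mul_assoc]
  have h1 : (2 : ℝ) ^ n * Q.j i < Q'.j i + 1 := lt_of_mul_lt_mul_left (a1.trans_lt b2) hpos.le
  have h2 : (Q'.j i : ℝ) < 2 ^ n * (Q.j i + 1) := lt_of_mul_lt_mul_left (b1.trans_lt a2) hpos.le
  have h1' : (2 : ℝ) ^ n * Q.j i ≤ Q'.j i := by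
    have : (2 : ℤ) ^ n * Q.j i < Q'.j i + 1 := mod_cast h1
    exact_mod_cast Int.lt_add_one_iff.1 this
  have h2' : (Q'.j i : ℝ) + 1 ≤ 2 ^ n * (Q.j i + 1) := by
    have : Q'.j i < (2 : ℤ) ^ n * (Q.j i + 1) := mod_cast h2
    exact_mod_cast Int.add_one_le_iff.2 this
  exact ⟨le_trans (by gcongr) c1, c2.trans_le (by gcongr)⟩

end DCube

/-- **Lemma of López-Sánchez, Martell, and Parcet.**  Let `1 ≤ p < ∞`, let `μ` be a locally
finite Borel measure on `ℝ^d`, let `h` be a nonnegative locally integrable function, and let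
`ℛ` be a collection of pairwise disjoint dyadic cubes, `R̂` denoting the dyadic parent of `R`.
Then `‖Σ_R (∫_R h dμ) 1_{R̂}/μ(R̂)‖_{L^p(μ)} ≤ C(p) (sup_R ⟨h⟩^μ_{R̂})^{1/p'} (∫_{∪R} h dμ)^{1/p}`
with `C(p)` depending only on `p`. -/
theorem smeared_sum_estimate (p : ℝ) (hp : 1 ≤ p) :
    ∃ Cp : ℝ≥0∞, Cp ≠ ⊤ ∧
      ∀ (d : ℕ) (μ : Measure (Fin d → ℝ)), IsLocallyFiniteMeasure μ →
        ∀ (ℛ : Finset (DCube d)),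
          (∀ R ∈ ℛ, ∀ R' ∈ ℛ, R ≠ R' → Disjoint R.toSet R'.toSet) →
          ∀ h : (Fin d → ℝ) → ℝ, (∀ x, 0 ≤ h x) → LocallyIntegrable h μ →
            (∫⁻ x, (∑ R ∈ ℛ, R.parent.toSet.indicator
                  (fun _ => (μ R.parent.toSet)⁻¹ *
                    ∫⁻ y in R.toSet, ENNReal.ofReal (h y) ∂μ) x) ^ p ∂μ) ^ (1 / p)
              ≤ Cp * (⨆ R ∈ ℛ, (μ R.parent.toSet)⁻¹ *
                      ∫⁻ y in R.parent.toSet, ENNReal.ofReal (h y) ∂μ) ^ (1 - 1 / p) *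
                  (∫⁻ x in (⋃ R ∈ ℛ, DCube.toSet R), ENNReal.ofReal (h x) ∂μ) ^ (1 / p) := by
  have hp0 : 0 < p := by linarith
  refine ⟨((1 + (⌈p⌉₊).factorial : ℕ) : ℝ≥0∞) ^ (1 / p),
    ENNReal.rpow_ne_top_of_nonneg (by positivity) (ENNReal.natCast_ne_top _), ?_⟩
  intro d μ _ ℛ hdisj h _ _
  have hdisj' : (ℛ : Set (DCube d)).PairwiseDisjoint DCube.toSet :=
    fun R hR R' hR' hne => hdisj R hR R' hR' hne
  rw [lintegral_biUnion_finset hdisj' fun R _ => R.measurableSet_toSet]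
  set A := ⨆ R ∈ ℛ, (μ R.parent.toSet)⁻¹ *
    ∫⁻ y in R.parent.toSet, ENNReal.ofReal (h y) ∂μ with hA
  have key := lintegral_smearedSum_rpow_le (μ := μ) (g := fun y => ENNReal.ofReal (h y))
    (E := DCube.toSet) (Q := fun R => R.parent.toSet) (k := fun R => R.parent.k) (T := ℛ) (A := A)
    (fun R => R.measurableSet_toSet) (fun R => R.parent.measurableSet_toSet)
    (fun R => R.toSet_subset_parent)
    (fun _ _ hk _ hx hx' => DCube.toSet_subset_of_mem_of_le hk hx hx') hdisj'
    (fun R hR => le_iSup₂_of_le R hR le_rfl) hp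
  have hexp : 1 - 1 / p = (p - 1) * (1 / p) := by field_simp
  rw [hexp, ENNReal.rpow_mul, ← ENNReal.mul_rpow_of_nonneg _ _ (by positivity),
    ← ENNReal.mul_rpow_of_nonneg _ _ (by positivity), mul_assoc]
  refine ENNReal.rpow_le_rpow ?_ (by positivity)
  push_cast
  exact key
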